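/- Let n ≥ 2. The Lie algebra u_n is a uniserial, Artinian but not Noetherian Lie algebra: (1) the set of Lie ideals of u_n is totally ordered by inclusion; (2) every strictly descending chain of ideals of u_n is finite (equivalently, every nonempty set of ideals of u_n has a minimal element); (3) there exists a strictly ascending infinite chain of ideals of u_n. -/

import Mathlib

open MvPolynomial

noncomputable section


/-- If a derivation of `MvPolynomial σ K` maps every generator `X j`, `j ∈ s`, into the
subalgebra `supported K s` of polynomials supported on `s`, then it maps the whole of
`supported K s` into itself. -/
theorem Derivation.mem_supported_of_forall_mem
    {K : Type*} [CommRing K] {σ : Type*} (s : Set σ)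
    (D : Derivation K (MvPolynomial σ K) (MvPolynomial σ K))
    (h : ∀ j ∈ s, D (X j) ∈ supported K s)
    {p : MvPolynomial σ K} (hp : p ∈ supported K s) : D p ∈ supported K s := by
  rw [supported_eq_adjoin_X] at hp
  induction hp using Algebra.adjoin_induction with
  | mem x hx =>
    obtain ⟨j, hj, rfl⟩ := hx
    exact h j hj
  | algebraMap r =>
    rw [Derivation.map_algebraMap]
    exact zero_mem _
  | add x y hx hy ihx ihy =>
    rw [map_add]
    exact add_mem ihx ihy
  | mul x y hx hy ihx ihy =>
    rw [Derivation.leibniz, smul_eq_mul, smul_eq_mul]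
    rw [← supported_eq_adjoin_X] at hx hy
    exact add_mem (mul_mem hx ihy) (mul_mem hy ihx)

/-- If a derivation of `MvPolynomial σ K` kills every generator `X j`, `j ∈ s`, then it
kills the whole subalgebra `supported K s`. -/
theorem Derivation.eq_zero_of_forall_eq_zero
    {K : Type*} [CommRing K] {σ : Type*} (s : Set σ)
    (D : Derivation K (MvPolynomial σ K) (MvPolynomial σ K))
    (h : ∀ j ∈ s, D (X j) = 0)
    {p : MvPolynomial σ K} (hp : p ∈ supported K s) : D p = 0 := by
  rw [supported_eq_adjoin_X] at hp
  induction hp using Algebra.adjoin_induction with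
  | mem x hx =>
    obtain ⟨j, hj, rfl⟩ := hx
    exact h j hj
  | algebraMap r =>
    rw [Derivation.map_algebraMap]
  | add x y hx hy ihx ihy =>
    rw [map_add, ihx, ihy, add_zero]
  | mul x y hx hy ihx ihy =>
    rw [Derivation.leibniz, ihx, ihy, smul_zero, smul_zero, add_zero]

/-- The defining condition for the Lie algebra `u_n = K∂₁ ⊕ P₁∂₂ ⊕ ⋯ ⊕ P_{n-1}∂ₙ` of
triangular polynomial derivations of `P_n = K[x₁,…,xₙ]` (variables indexed by `Fin n`,
zero-based): a derivation `D` of `P_n` is triangular iff, for every `i`, the polynomial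
`D (X i)` only involves the variables `X j` with `j < i` (so the coefficient of `∂_i`
lies in `P_{i-1}`, where `P₀ = K`). -/
def triSet (K : Type*) [Field K] (n : ℕ) :
    Set (Derivation K (MvPolynomial (Fin n) K) (MvPolynomial (Fin n) K)) :=
  {D | ∀ i : Fin n, D (X i) ∈ supported K {j : Fin n | (j : ℕ) < (i : ℕ)}}

theorem supported_upward {K : Type*} [Field K] {n : ℕ}
    (p : MvPolynomial (Fin n) K) (s t : Set (Fin n)) (hst : s ⊆ t)
    (hp : p ∈ supported K s) : p ∈ supported K t :=
  supported_mono hst hp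

theorem triSet_stable {K : Type*} [Field K] {n : ℕ}
    {D : Derivation K (MvPolynomial (Fin n) K) (MvPolynomial (Fin n) K)}
    (hD : D ∈ triSet K n) (i : Fin n) :
    ∀ j ∈ {j' : Fin n | (j' : ℕ) < (i : ℕ)},
      D (X j) ∈ supported K {j' : Fin n | (j' : ℕ) < (i : ℕ)} := by
  intro j hj
  refine supported_upward _ {j' : Fin n | (j' : ℕ) < (j : ℕ)} _ ?_ (hD j)
  intro l hl
  have hl' : (l : ℕ) < (j : ℕ) := hl
  have hj' : (j : ℕ) < (i : ℕ) := hj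
  exact lt_trans hl' hj'

theorem triSet_lie {K : Type*} [Field K] {n : ℕ}
    {a b : Derivation K (MvPolynomial (Fin n) K) (MvPolynomial (Fin n) K)}
    (ha : a ∈ triSet K n) (hb : b ∈ triSet K n) : ⁅a, b⁆ ∈ triSet K n := by
  intro i
  rw [Derivation.commutator_apply]
  exact sub_mem
    (Derivation.mem_supported_of_forall_mem _ a (triSet_stable ha i) (hb i))
    (Derivation.mem_supported_of_forall_mem _ b (triSet_stable hb i) (ha i))

/-- The Lie algebra `u_n = K∂₁ ⊕ P₁∂₂ ⊕ ⋯ ⊕ P_{n-1}∂ₙ` of triangular polynomial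
derivations, as a Lie subalgebra of the Lie algebra of all `K`-derivations of the
polynomial algebra `P_n = K[x₁,…,xₙ]`. -/
def triangular (K : Type*) [Field K] (n : ℕ) :
    LieSubalgebra K (Derivation K (MvPolynomial (Fin n) K) (MvPolynomial (Fin n) K)) where
  carrier := triSet K n
  add_mem' := fun {a b} ha hb i => by
    rw [Derivation.add_apply]; exact add_mem (ha i) (hb i)
  zero_mem' := fun i => by
    rw [Derivation.zero_apply]; exact zero_mem _
  smul_mem' := fun c a ha i => by
    rw [Derivation.smul_apply]; exact Subalgebra.smul_mem _ (ha i) c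
  lie_mem' := fun {a b} ha hb => triSet_lie ha hb

theorem mem_triangular_iff {K : Type*} [Field K] {n : ℕ}
    (D : Derivation K (MvPolynomial (Fin n) K) (MvPolynomial (Fin n) K)) :
    D ∈ triangular K n ↔
      ∀ i : Fin n, D (X i) ∈ supported K {j : Fin n | (j : ℕ) < (i : ℕ)} := Iff.rfl

namespace TriAux

abbrev Idx (n : ℕ) := Fin n × (Fin n →₀ ℕ)

abbrev Der (K : Type*) [Field K] (n : ℕ) :=
  Derivation K (MvPolynomial (Fin n) K) (MvPolynomial (Fin n) K)

def key {n : ℕ} (m : Idx n) : ℕ ×ₗ Colex (Fin n → ℕ) :=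
  toLex (n - (m.1 : ℕ), toColex (m.2 : Fin n → ℕ))

theorem key_wf (n : ℕ) : WellFounded (fun a b : ℕ ×ₗ Colex (Fin n → ℕ) => a < b) := by
  have h : WellFoundedLT (Colex (Fin n → ℕ)) :=
    ⟨Pi.Lex.wellFounded (fun a b : Fin n => b < a) (fun _ => wellFounded_lt)⟩
  exact WellFounded.prod_lex wellFounded_lt h.wf

theorem colex_lt_iff {n : ℕ} (a b : Fin n → ℕ) :
    toColex a < toColex b ↔ ∃ p, (∀ j, p < j → a j = b j) ∧ a p < b p := Iff.rfl

theorem key_lt_iff {n : ℕ} (m m' : Idx n) : key m < key m' ↔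
    m'.1 < m.1 ∨ (m.1 = m'.1 ∧ ∃ p, (∀ j, p < j → m.2 j = m'.2 j) ∧ m.2 p < m'.2 p) := by
  unfold key
  rw [Prod.Lex.toLex_lt_toLex, colex_lt_iff]
  have h1 := m.1.2
  have h2 := m'.1.2
  simp only [Fin.lt_def, Fin.ext_iff]
  refine or_congr (by omega) (and_congr_left' (by omega))

theorem not_key_le {n : ℕ} (m m' : Idx n) : ¬ key m ≤ key m' ↔ key m' < key m := by
  exact not_le

theorem natCast_succ_ne {K : Type*} [Field K] [CharZero K] (c : ℕ) : (c : K) + 1 ≠ 0 :=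
  Nat.cast_add_one_ne_zero c

theorem key_inj {n : ℕ} {m m' : Idx n} (h : key m = key m') : m = m' := by
  unfold key at h
  have h' := toLex.injective h
  rw [Prod.mk.injEq] at h'
  obtain ⟨h1, h2⟩ := h'
  have h3 := m.1.2
  have h4 := m'.1.2
  ext j
  · omega
  · exact congrFun (toColex.injective h2) j

def Valid {n : ℕ} (m : Idx n) : Prop := ∀ j, m.1 ≤ j → m.2 j = 0

variable {K : Type*} [Field K] {n : ℕ}

theorem mem_supported_iff (s : Set (Fin n)) (p : MvPolynomial (Fin n) K) :
    p ∈ supported K s ↔ ∀ γ, coeff γ p ≠ 0 → ∀ j, γ j ≠ 0 → j ∈ s := by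
  rw [mem_supported]
  constructor
  · intro h γ hγ j hj
    apply h
    simp only [Finset.mem_coe]
    rw [mem_vars_iff_mem_support]
    exact ⟨γ, mem_support_iff.2 hγ, Finsupp.mem_support_iff.2 hj⟩
  · intro h j hj
    simp only [Finset.mem_coe] at hj
    rw [mem_vars_iff_mem_support] at hj
    obtain ⟨γ, hγ, hj⟩ := hj
    exact h γ (mem_support_iff.1 hγ) j (Finsupp.mem_support_iff.1 hj)

theorem valid_of_coeff {a : Der K n} (ha : a ∈ triangular K n) {m : Idx n}
    (h : coeff m.2 (a (X m.1)) ≠ 0) : Valid m := by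
  intro j hj
  by_contra hne
  have := (mem_supported_iff _ _).1 (ha m.1) m.2 h j hne
  simp only [Set.mem_ofPred_eq] at this
  exact absurd hj (by rw [Fin.le_def]; omega)

def bas (K : Type*) [Field K] {n : ℕ} (m : Idx n) : Der K n :=
  (monomial m.2 (1 : K)) • pderiv m.1

theorem bas_X (m : Idx n) (j : Fin n) :
    bas K m (X j) = if m.1 = j then monomial m.2 1 else 0 := by
  classical
  unfold bas
  rw [Derivation.smul_apply, pderiv_X, smul_eq_mul]
  by_cases h : m.1 = j
  · subst h; simp
  · simp [h, Pi.single_apply]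

theorem bas_mem {m : Idx n} (h : Valid m) : bas K m ∈ triangular K n := by
  intro i
  rw [bas_X]
  split_ifs with hi
  · subst hi
    rw [mem_supported_iff]
    intro γ hγ j hj
    rw [coeff_monomial] at hγ
    have : m.2 = γ := by by_contra h; simp [h] at hγ
    subst this
    by_contra hlt
    apply hj
    apply h
    simp only [Set.mem_ofPred_eq] at hlt
    rw [Fin.le_def]; omega
  · exact zero_mem _

/-- index set of the nonzero coefficients -/
def idx (a : Der K n) : Finset (Σ _ : Fin n, (Fin n →₀ ℕ)) :=
  Finset.univ.sigma (fun i => (a (X i)).support)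

theorem expand (a : Der K n) :
    a = ∑ s ∈ idx a, coeff s.2 (a (X s.1)) • bas K (s.1, s.2) := by
  classical
  apply derivation_ext
  intro j
  unfold idx
  rw [Finset.sum_sigma]
  have hs : ∀ (t : Finset (Fin n)) (f : Fin n → Der K n),
      (∑ i ∈ t, f i) (X j) = ∑ i ∈ t, f i (X j) := by
    intro t f
    induction t using Finset.induction_on with
    | empty => simp
    | insert x s hx ih => rw [Finset.sum_insert hx, Finset.sum_insert hx, Derivation.add_apply, ih]
  have hs' : ∀ (t : Finset (Fin n →₀ ℕ)) (f : (Fin n →₀ ℕ) → Der K n),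
      (∑ i ∈ t, f i) (X j) = ∑ i ∈ t, f i (X j) := by
    intro t f
    induction t using Finset.induction_on with
    | empty => simp
    | insert x s hx ih => rw [Finset.sum_insert hx, Finset.sum_insert hx, Derivation.add_apply, ih]
  rw [hs]
  simp only [hs', Derivation.smul_apply, bas_X]
  rw [Finset.sum_eq_single j]
  · simp only [if_true, smul_monomial, smul_eq_mul, mul_one]
    exact (support_sum_monomial_coeff _).symm
  · intro b _ hb
    simp [hb]
  · simp

/-- an ideal as a submodule of the ambient space of derivations -/
def amb (I : LieIdeal K ↥(triangular K n)) : Submodule K (Der K n) :=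
  I.toSubmodule.map (triangular K n).toSubmodule.subtype

theorem mem_amb {I : LieIdeal K ↥(triangular K n)} {a : Der K n} :
    a ∈ amb I ↔ ∃ h : a ∈ triangular K n, (⟨a, h⟩ : ↥(triangular K n)) ∈ I := by
  unfold amb
  rw [Submodule.mem_map]
  constructor
  · rintro ⟨⟨x, hx⟩, hxI, rfl⟩
    exact ⟨hx, hxI⟩
  · rintro ⟨h, hI⟩
    exact ⟨⟨a, h⟩, hI, rfl⟩

theorem amb_lie {I : LieIdeal K ↥(triangular K n)} {a d : Der K n} (ha : a ∈ amb I)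
    (hd : d ∈ triangular K n) : ⁅d, a⁆ ∈ amb I := by
  obtain ⟨h, hI⟩ := mem_amb.1 ha
  exact mem_amb.2 ⟨triSet_lie hd h, lie_mem_right K _ I ⟨d, hd⟩ ⟨a, h⟩ hI⟩

theorem amb_of_coeffs {I : LieIdeal K ↥(triangular K n)} {a : Der K n}
    (h : ∀ m : Idx n, coeff m.2 (a (X m.1)) ≠ 0 → bas K m ∈ amb I) : a ∈ amb I := by
  rw [expand a]
  apply Submodule.sum_mem
  intro s hs
  apply Submodule.smul_mem
  apply h (s.1, s.2)
  unfold idx at hs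
  rw [Finset.mem_sigma] at hs
  exact mem_support_iff.1 hs.2

def Lead (a : Der K n) (m : Idx n) : Prop :=
  coeff m.2 (a (X m.1)) ≠ 0 ∧ ∀ m' : Idx n, coeff m'.2 (a (X m'.1)) ≠ 0 → key m' ≤ key m

theorem Lead.zero_of_lt {a : Der K n} {m : Idx n} (h : Lead a m) {j : Fin n} (hj : j < m.1) :
    a (X j) = 0 := by
  ext γ
  rw [coeff_zero]
  by_contra hne
  have := h.2 (j, γ) hne
  apply absurd this
  rw [not_key_le, key_lt_iff]
  exact Or.inl hj

theorem zero_on {a : Der K n} {s : Set (Fin n)} (h : ∀ j ∈ s, a (X j) = 0) {γ : Fin n →₀ ℕ}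
    (hγ : ∀ j, γ j ≠ 0 → j ∈ s) : a (monomial γ (1 : K)) = 0 := by
  apply Derivation.eq_zero_of_forall_eq_zero s a h
  rw [mem_supported_iff]
  intro γ' h' j hj
  rw [coeff_monomial] at h'
  have : γ = γ' := by by_contra h; simp [h] at h'
  subst this
  exact hγ j hj

theorem coeff_shift [CharZero K] (δ γ : Fin n →₀ ℕ) (k : Fin n) (p : MvPolynomial (Fin n) K) :
    coeff γ (monomial δ (1 : K) * pderiv k p) ≠ 0 ↔
      δ ≤ γ ∧ coeff (γ - δ + Finsupp.single k 1) p ≠ 0 := by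
  rw [coeff_monomial_mul']
  split_ifs with h
  · rw [coeff_pderiv, one_mul]
    have : (((γ - δ) k : ℕ) : K) + 1 ≠ 0 := natCast_succ_ne _
    rw [mul_ne_zero_iff]
    exact ⟨fun hh => ⟨h, hh.1⟩, fun hh => ⟨hh.2, this⟩⟩
  · simp [h]

/-- descent step inside `P_{i-1} ∂_i` -/
theorem step_one [CharZero K] {I : LieIdeal K ↥(triangular K n)} {a : Der K n} (ha : a ∈ amb I)
    {m : Idx n} (hm : Lead a m) (k : Fin n) (hk : m.2 k ≠ 0) (δ : Fin n →₀ ℕ)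
    (hδ : Valid (k, δ)) :
    ∃ b ∈ amb I, Lead b (m.1, m.2 - Finsupp.single k 1 + δ) ∧
      key (m.1, m.2 - Finsupp.single k 1 + δ) < key m := by
  have hv : Valid m := valid_of_coeff (mem_amb.1 ha).1 hm.1
  have hki : k < m.1 := by
    by_contra h
    exact hk (hv k (not_lt.1 h))
  have hb : ∀ j, ⁅bas K (k, δ), a⁆ (X j) = monomial δ (1 : K) * pderiv k (a (X j)) := by
    intro j
    rw [Derivation.commutator_apply, bas_X]
    have : a (if k = j then monomial δ (1 : K) else 0) = 0 := by
      split_ifs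
      · apply zero_on (s := {j | j < k})
        · intro j hj
          exact hm.zero_of_lt (lt_trans hj hki)
        · intro j hj
          by_contra h
          exact hj (hδ j (not_lt.1 h))
      · exact map_zero _
    simp only [this, sub_zero]
    rfl
  refine ⟨⁅bas K (k, δ), a⁆, amb_lie ha (bas_mem hδ), ⟨?_, ?_⟩, ?_⟩
  · simp only [hb]
    rw [coeff_shift]
    refine ⟨le_add_self, ?_⟩
    have : m.2 - Finsupp.single k 1 + δ - δ + Finsupp.single k 1 = m.2 := by
      ext j
      simp only [Finsupp.add_apply, Finsupp.tsub_apply, Finsupp.single_apply]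
      split_ifs with h
      · subst h; omega
      · omega
    rw [this]
    exact hm.1
  · rintro ⟨j, γ⟩ h
    simp only [hb] at h
    rw [coeff_shift] at h
    obtain ⟨h1, h2⟩ := h
    have := hm.2 (j, _) h2
    by_contra hlt
    rw [not_key_le] at hlt
    apply absurd this
    rw [not_key_le]
    rw [key_lt_iff] at hlt ⊢
    simp only at hlt ⊢
    refine hlt.imp id (And.imp id ?_)
    rintro ⟨p, hp, hp'⟩
    have hpt : ∀ q, (γ - δ + Finsupp.single k 1 : Fin n →₀ ℕ) q = γ q - δ q + if k = q then 1 else 0 := by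
      intro q
      simp only [Finsupp.add_apply, Finsupp.tsub_apply, Finsupp.single_apply]
    have hpt2 : ∀ q, (m.2 - Finsupp.single k 1 + δ : Fin n →₀ ℕ) q = m.2 q - (if k = q then 1 else 0) + δ q := by
      intro q
      simp only [Finsupp.add_apply, Finsupp.tsub_apply, Finsupp.single_apply]
    have key1 : ∀ q, (if k = q then 1 else 0) ≤ m.2 q := by
      intro q
      split_ifs with h
      · subst h; omega
      · omega
    refine ⟨p, ?_, ?_⟩
    · intro q hq
      have e := hp q hq
      rw [hpt2] at e
      rw [hpt]
      have := h1 q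
      have := key1 q
      omega
    · rw [hpt2] at hp'
      rw [hpt]
      have := h1 p
      have := key1 p
      omega
  · rw [key_lt_iff]
    refine Or.inr ⟨rfl, k, ?_, ?_⟩
    · intro j hj
      have : δ j = 0 := hδ j hj.le
      simp [Finsupp.single_apply, hj.ne, this]
    · have : δ k = 0 := hδ k le_rfl
      simp [this]
      omega

/-- descent step from `∂_i` to `P_i ∂_{i+1}` -/
theorem step_two [CharZero K] {I : LieIdeal K ↥(triangular K n)} {a : Der K n} (ha : a ∈ amb I)
    {m : Idx n} (hm : Lead a m) (h0 : m.2 = 0) (i' : Fin n) (hi' : (i' : ℕ) = m.1 + 1)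
    (γ : Fin n →₀ ℕ) (hγ : Valid (i', γ)) :
    ∃ b ∈ amb I, Lead b (i', γ) ∧ key (i', γ) < key m := by
  obtain ⟨i, β⟩ := m
  simp only at h0 hi'
  subst h0
  have hii : i < i' := by rw [Fin.lt_def]; omega
  have haT := (mem_amb.1 ha).1
  obtain ⟨c, hc⟩ : ∃ c : K, a (X i) = C c := by
    refine ⟨coeff 0 (a (X i)), ?_⟩
    ext γ
    rw [coeff_C]
    split_ifs with h
    · rw [h]
    · by_contra hne
      have := hm.2 (i, γ) hne
      rcases this.lt_or_eq with h' | h'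
      · rw [key_lt_iff] at h'
        simp at h'
      · have := key_inj h'
        simp only [Prod.mk.injEq] at this
        exact h this.2.symm
  have hc0 : c ≠ 0 := by
    have := hm.1
    simp only [hc, coeff_C] at this
    simpa using this
  have hdv : Valid (i', γ + Finsupp.single i 1) := by
    intro j hj
    have h1 : γ j = 0 := hγ j hj
    have h2 : i ≠ j := fun h => by subst h; exact absurd hii (not_lt.2 hj)
    simp [h1, Finsupp.single_apply, h2]
  have hae : a (monomial (γ + Finsupp.single i 1) (1 : K)) = monomial γ (c * (γ i + 1)) := by
    have h1 : (a - (C c : MvPolynomial (Fin n) K) • (pderiv i : Der K n)) (monomial (γ + Finsupp.single i 1) (1 : K)) = 0 := by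
      apply zero_on (s := {j | j < i'})
      · intro j hj
        have hj : j < i' := hj
        rw [Derivation.sub_apply, Derivation.smul_apply]
        by_cases hji : j = i
        · subst hji
          simp [hc]
        · have : j < i := by
            rw [Fin.lt_def] at hj ⊢
            have : (j : ℕ) ≠ i := fun h => hji (Fin.ext h)
            omega
          rw [hm.zero_of_lt this, pderiv_X_of_ne hji]
          simp
      · intro j hj
        by_contra h
        exact hj (hdv j (not_lt.1 h))
    rw [Derivation.sub_apply, sub_eq_zero, Derivation.smul_apply, pderiv_monomial, smul_eq_mul,
      C_mul_monomial] at h1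
    rw [h1]
    simp
  have hb : ∀ j, ⁅bas K (i', γ + Finsupp.single i 1), a⁆ (X j) =
      monomial (γ + Finsupp.single i 1) (1 : K) * pderiv i' (a (X j)) -
        if i' = j then monomial γ (c * (γ i + 1)) else 0 := by
    intro j
    rw [Derivation.commutator_apply, bas_X]
    have : a (if i' = j then monomial (γ + Finsupp.single i 1) (1 : K) else 0) =
        if i' = j then monomial γ (c * (γ i + 1)) else 0 := by
      split_ifs
      · exact hae
      · exact map_zero _
    simp only [this]
    rfl
  have hpd : ∀ j, j ≤ i' → pderiv i' (a (X j)) = 0 := by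
    intro j hj
    apply pderiv_eq_zero_of_notMem_vars
    intro hv
    have := mem_supported.1 (haT j) hv
    simp only [Set.mem_ofPred_eq] at this
    rw [Fin.le_def] at hj
    omega
  have hne : c * ((γ i : K) + 1) ≠ 0 :=
    mul_ne_zero hc0 (natCast_succ_ne _)
  refine ⟨_, amb_lie ha (bas_mem hdv), ⟨?_, ?_⟩, ?_⟩
  · simp only [hb]
    rw [hpd i' le_rfl]
    simpa [coeff_monomial] using hne
  · rintro ⟨j, γ'⟩ h
    simp only [hb] at h
    rcases lt_trichotomy j i' with hj | hj | hj
    · rw [hpd j hj.le] at h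
      simp [hj.ne'] at h
    · subst hj
      rw [hpd j le_rfl] at h
      have : γ = γ' := by
        by_contra h'
        simp [coeff_monomial, h'] at h
      rw [this]
    · apply le_of_lt
      rw [key_lt_iff]
      exact Or.inl hj
  · rw [key_lt_iff]
    exact Or.inl hii

theorem cofinal [CharZero K] {I : LieIdeal K ↥(triangular K n)} {a : Der K n} (ha : a ∈ amb I)
    {m : Idx n} (hm : Lead a m) {m' : Idx n} (hv' : Valid m') (hlt : key m' < key m) :
    ∃ m'' : Idx n, ∃ b ∈ amb I, Lead b m'' ∧ key m'' < key m ∧ key m' ≤ key m'' := by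
  classical
  rcases (key_lt_iff _ _).1 hlt with h | ⟨h, p, hp, hp'⟩
  · by_cases h0 : m.2 = 0
    · have hlt' : (m.1 : ℕ) + 1 < n := by
        have := m'.1.2
        rw [Fin.lt_def] at h
        omega
      by_cases he : (m'.1 : ℕ) = m.1 + 1
      · obtain ⟨b, hb, h1, h2⟩ := step_two ha hm h0 m'.1 he m'.2 hv'
        exact ⟨m', b, hb, h1, h2, le_rfl⟩
      · obtain ⟨b, hb, h1, h2⟩ := step_two ha hm h0 ⟨m.1 + 1, hlt'⟩ rfl 0 (fun _ _ => rfl)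
        refine ⟨_, b, hb, h1, h2, le_of_lt ?_⟩
        rw [key_lt_iff]
        left
        rw [Fin.lt_def] at h ⊢
        simp only
        omega
    · obtain ⟨k, hk⟩ := Finsupp.ne_iff.1 h0
      obtain ⟨b, hb, h1, h2⟩ := step_one ha hm k hk 0 (fun _ _ => rfl)
      refine ⟨_, b, hb, h1, h2, le_of_lt ?_⟩
      rw [key_lt_iff]
      exact Or.inl h
  · have hv : Valid (p, m'.2.filter (fun j => j < p)) := by
      intro j hj
      exact Finsupp.filter_apply_neg _ _ (not_lt.2 hj)
    obtain ⟨b, hb, h1, h2⟩ := step_one ha hm p (by omega) _ hv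
    refine ⟨_, b, hb, h1, h2, ?_⟩
    unfold key
    rw [h]
    rw [Prod.Lex.toLex_le_toLex]
    refine Or.inr ⟨rfl, Pi.toColex_monotone ?_⟩
    intro j
    simp only [Finsupp.add_apply, Finsupp.tsub_apply, Finsupp.single_apply, Finsupp.filter_apply]
    rcases lt_trichotomy j p with hj | hj | hj
    · simp [hj]
    · subst hj
      simp
      omega
    · simp [hj.ne, hp j hj]

theorem main_lead [CharZero K] {I : LieIdeal K ↥(triangular K n)} (m : Idx n) :
    ∀ a ∈ amb I, Lead a m → ∀ m' : Idx n, Valid m' → key m' ≤ key m → bas K m' ∈ amb I := by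
  induction m using (InvImage.wf key (key_wf n)).induction with
  | _ m ih =>
  intro a ha hm
  have hlt : ∀ m' : Idx n, Valid m' → key m' < key m → bas K m' ∈ amb I := by
    intro m' hv' h
    obtain ⟨m'', b, hb, h1, h2, h3⟩ := cofinal ha hm hv' h
    exact ih m'' h2 b hb h1 m' hv' h3
  intro m' hv' hle
  rcases hle.lt_or_eq with h | h
  · exact hlt m' hv' h
  have := key_inj h
  subst this
  have h1 : a - coeff m'.2 (a (X m'.1)) • bas K m' ∈ amb I := by
    apply amb_of_coeffs
    intro q hq
    rw [Derivation.sub_apply, Derivation.smul_apply, bas_X, coeff_sub, coeff_smul] at hq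
    by_cases hqm : q = m'
    · subst hqm
      simp at hq
    · have h2 : coeff q.2 (if m'.1 = q.1 then monomial m'.2 (1 : K) else 0) = 0 := by
        split_ifs with h3
        · rw [coeff_monomial, if_neg]
          intro h4
          exact hqm (Prod.ext h3.symm h4.symm)
        · simp
      rw [h2, smul_zero, sub_zero] at hq
      apply hlt q (valid_of_coeff (mem_amb.1 ha).1 hq)
      exact lt_of_le_of_ne (hm.2 q hq) (fun h => hqm (key_inj h))
  have h2 := Submodule.sub_mem _ ha h1
  rw [sub_sub_cancel] at h2
  exact (Submodule.smul_mem_iff _ hm.1).1 h2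

theorem main_coeff [CharZero K] {I : LieIdeal K ↥(triangular K n)} {a : Der K n}
    (ha : a ∈ amb I) {m : Idx n} (hm : coeff m.2 (a (X m.1)) ≠ 0) {m' : Idx n} (hv : Valid m')
    (h : key m' ≤ key m) : bas K m' ∈ amb I := by
  have hmem : ∀ q : Idx n, coeff q.2 (a (X q.1)) ≠ 0 →
      (⟨q.1, q.2⟩ : Σ _ : Fin n, (Fin n →₀ ℕ)) ∈ idx a := by
    intro q hq
    unfold idx
    rw [Finset.mem_sigma]
    exact ⟨Finset.mem_univ _, mem_support_iff.2 hq⟩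
  obtain ⟨s, hs, hmax⟩ := Finset.exists_max_image (idx a)
    (fun s => key ((s.1, s.2) : Idx n)) ⟨_, hmem m hm⟩
  have hl : Lead a (s.1, s.2) := by
    refine ⟨?_, fun q hq => hmax _ (hmem q hq)⟩
    unfold idx at hs
    rw [Finset.mem_sigma] at hs
    exact mem_support_iff.1 hs.2
  exact main_lead _ a ha hl m' hv (h.trans (hmax _ (hmem m hm)))

theorem bas_coeff (m : Idx n) : coeff m.2 (bas K m (X m.1)) ≠ 0 := by
  rw [bas_X]
  simp

theorem down [CharZero K] {I : LieIdeal K ↥(triangular K n)} {m m' : Idx n}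
    (hm : bas K m ∈ amb I) (hv : Valid m') (h : key m' ≤ key m) : bas K m' ∈ amb I :=
  main_coeff hm (bas_coeff m) hv h

theorem le_of_bas [CharZero K] {I J : LieIdeal K ↥(triangular K n)}
    (h : ∀ m, Valid m → bas K m ∈ amb I → bas K m ∈ amb J) : I ≤ J := by
  rintro ⟨a, haT⟩ ha
  have ha' : a ∈ amb I := mem_amb.2 ⟨haT, ha⟩
  have : a ∈ amb J := by
    apply amb_of_coeffs
    intro m hm
    have hv := valid_of_coeff haT hm
    exact h m hv (main_coeff ha' hm hv le_rfl)
  exact (mem_amb.1 this).2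

/-- the ascending chain -/
def chain (K : Type*) [Field K] (n : ℕ) (p q : Fin n) (hpq : (q : ℕ) = p + 1)
    (hq : ∀ j : Fin n, j ≤ q) (N : ℕ) : LieIdeal K ↥(triangular K n) where
  carrier := {D | (∀ j, j ≠ q → D.1 (X j) = 0) ∧ (pderiv p)^[N] (D.1 (X q)) = 0}
  add_mem' := by
    rintro a b ⟨h1, h2⟩ ⟨h3, h4⟩
    refine ⟨fun j hj => ?_, ?_⟩
    · change a.1 (X j) + b.1 (X j) = 0
      rw [h1 j hj, h3 j hj, add_zero]
    · change (pderiv p)^[N] (a.1 (X q) + b.1 (X q)) = 0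
      rw [iterate_map_add, h2, h4, add_zero]
  zero_mem' := ⟨fun j _ => rfl, iterate_map_zero _ _⟩
  smul_mem' := by
    rintro c a ⟨h1, h2⟩
    refine ⟨fun j hj => ?_, ?_⟩
    · change c • a.1 (X j) = 0
      rw [h1 j hj, smul_zero]
    · change (pderiv p)^[N] (c • a.1 (X q)) = 0
      have : ∀ N : ℕ, ∀ r : MvPolynomial (Fin n) K,
          (pderiv p)^[N] (c • r) = c • (pderiv p)^[N] r := by
        intro N
        induction N with
        | zero => intro r; rfl
        | succ N ih => intro r; rw [Function.iterate_succ_apply, Derivation.map_smul, ih,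
            Function.iterate_succ_apply]
      rw [this, h2, smul_zero]
  lie_mem := by
    rintro ⟨d, hd⟩ ⟨a, haT⟩ ⟨h1, h2⟩
    simp only at h1 h2
    have hz : ∀ j, a (d (X j)) = 0 := by
      intro j
      apply Derivation.eq_zero_of_forall_eq_zero _ a _ (hd j)
      intro l hl
      apply h1
      rintro rfl
      have := hq j
      rw [Fin.le_def] at this
      simp only [Set.mem_ofPred_eq] at hl
      omega
    refine ⟨fun j hj => ?_, ?_⟩
    · change ⁅d, a⁆ (X j) = 0
      rw [Derivation.commutator_apply, hz, h1 j hj, map_zero, sub_zero]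
    · change (pderiv p)^[N] (⁅d, a⁆ (X q)) = 0
      rw [Derivation.commutator_apply, hz, sub_zero]
      have hcomm : ∀ r ∈ supported K {j : Fin n | (j : ℕ) < (q : ℕ)},
          pderiv p (d r) = d (pderiv p r) := by
        intro r hr
        have := Derivation.eq_zero_of_forall_eq_zero _ ⁅(pderiv p : Der K n), d⁆ ?_ hr
        · rwa [Derivation.commutator_apply, sub_eq_zero] at this
        · intro j hj
          rw [Derivation.commutator_apply]
          have e1 : pderiv p (d (X j)) = 0 := by
            apply pderiv_eq_zero_of_notMem_vars
            intro hv
            have := mem_supported.1 (hd j) hv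
            simp only [Set.mem_ofPred_eq] at this hj
            omega
          have e2 : d (pderiv p (X j)) = 0 := by
            classical
            rw [pderiv_X, Pi.single_apply]
            split_ifs
            · exact Derivation.map_one_eq_zero d
            · exact map_zero d
          rw [e1, e2, sub_zero]
      have hst : ∀ r ∈ supported K {j : Fin n | (j : ℕ) < (q : ℕ)},
          pderiv p r ∈ supported K {j : Fin n | (j : ℕ) < (q : ℕ)} := by
        intro r hr
        apply Derivation.mem_supported_of_forall_mem _ _ _ hr
        intro j hj
        classical
        rw [pderiv_X, Pi.single_apply]
        split_ifs
        · exact one_mem _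
        · exact zero_mem _
      have hit : ∀ N : ℕ, ∀ r ∈ supported K {j : Fin n | (j : ℕ) < (q : ℕ)},
          (pderiv p)^[N] (d r) = d ((pderiv p)^[N] r) := by
        intro N
        induction N with
        | zero => intro r _; rfl
        | succ N ih =>
          intro r hr
          rw [Function.iterate_succ_apply, hcomm r hr, ih _ (hst r hr),
            Function.iterate_succ_apply]
      rw [hit N _ (haT q), h2, map_zero]

theorem mem_chain (p q : Fin n) (hpq : (q : ℕ) = p + 1)
    (hq : ∀ j : Fin n, j ≤ q) (N : ℕ) (D : ↥(triangular K n)) : D ∈ chain K n p q hpq hq N ↔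
    (∀ j, j ≠ q → D.1 (X j) = 0) ∧ (pderiv p)^[N] (D.1 (X q)) = 0 := Iff.rfl

theorem iter_mono (p : Fin n) (N : ℕ) : ∀ c : K,
    (pderiv p)^[N] (monomial (Finsupp.single p N) c) = C (c * (N.factorial : K)) := by
  induction N with
  | zero => intro c; simp
  | succ N ih =>
    intro c
    rw [Function.iterate_succ_apply, pderiv_monomial_single, Nat.add_sub_cancel, ih,
      Nat.factorial_succ]
    push_cast
    rw [mul_assoc]

theorem chain_strict [CharZero K] (p q : Fin n) (hpq : (q : ℕ) = p + 1)
    (hq : ∀ j : Fin n, j ≤ q) : StrictMono (chain K n p q hpq hq) := by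
  apply strictMono_nat_of_lt_succ
  intro N
  refine lt_of_le_of_ne ?_ ?_
  · intro D hD
    rw [mem_chain] at hD ⊢
    refine ⟨hD.1, ?_⟩
    rw [Function.iterate_succ_apply', hD.2, map_zero]
  · intro heq
    have hv : Valid (q, Finsupp.single p N) := by
      intro j hj
      apply Finsupp.single_eq_of_ne
      rintro rfl
      rw [Fin.le_def] at hj
      simp only at hj
      omega
    have h1 : (⟨bas K (q, Finsupp.single p N), bas_mem hv⟩ : ↥(triangular K n)) ∈
        chain K n p q hpq hq (N + 1) := by
      rw [mem_chain]
      simp only [bas_X, if_true]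
      refine ⟨fun j hj => by simp [hj.symm], ?_⟩
      rw [Function.iterate_succ_apply', iter_mono, pderiv_C]
    rw [← heq, mem_chain] at h1
    have h2 := h1.2
    simp only [bas_X, if_true, iter_mono, one_mul] at h2
    have h3 := C_eq_zero.1 h2
    exact Nat.factorial_ne_zero N (by exact_mod_cast h3)

end TriAux

/-- For `n ≥ 2`, the Lie algebra `u_n` is uniserial (its ideals are
totally ordered by inclusion), Artinian (every nonempty family of ideals has a minimal
element) but not Noetherian (there is a strictly ascending infinite chain of ideals). -/
theorem triangular_uniserial_artinian_not_noetherian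
    (K : Type*) [Field K] [CharZero K] (n : ℕ) (hn : 2 ≤ n) :
    (∀ I J : LieIdeal K ↥(triangular K n), I ≤ J ∨ J ≤ I) ∧
    (∀ S : Set (LieIdeal K ↥(triangular K n)), S.Nonempty →
      ∃ I ∈ S, ∀ J ∈ S, J ≤ I → J = I) ∧
    (∃ f : ℕ → LieIdeal K ↥(triangular K n), StrictMono f) := by
  refine ⟨?_, ?_, ?_⟩
  · intro I J
    by_cases h : ∀ m, TriAux.Valid m → TriAux.bas K m ∈ TriAux.amb I → TriAux.bas K m ∈ TriAux.amb J
    · exact Or.inl (TriAux.le_of_bas h)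
    · right
      push Not at h
      obtain ⟨m, hv, hI, hJ⟩ := h
      apply TriAux.le_of_bas
      intro m' hv' hm'
      rcases le_total (TriAux.key m) (TriAux.key m') with h | h
      · exact absurd (TriAux.down hm' hv h) hJ
      · exact TriAux.down hI hv' h
  · intro S hS
    by_cases hT : ∃ m : TriAux.Idx n, TriAux.Valid m ∧ ∃ J ∈ S, TriAux.bas K m ∉ TriAux.amb J
    · obtain ⟨m, ⟨hv, J, hJS, hJ⟩, hmin⟩ :=
        (InvImage.wf TriAux.key (TriAux.key_wf n)).has_min
          {m : TriAux.Idx n | TriAux.Valid m ∧ ∃ J ∈ S, TriAux.bas K m ∉ TriAux.amb J} hT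
      refine ⟨J, hJS, fun J' hJ'S hle => le_antisymm hle ?_⟩
      apply TriAux.le_of_bas
      intro m' hv' hm'
      by_contra hno
      have h1 := hmin m' ⟨hv', J', hJ'S, hno⟩
      exact hJ (TriAux.down hm' hv (not_lt.1 h1))
    · push Not at hT
      obtain ⟨I, hI⟩ := hS
      exact ⟨I, hI, fun J hJ hle => le_antisymm hle
        (TriAux.le_of_bas (fun m hv _ => hT m hv J hJ))⟩
  · exact ⟨_, TriAux.chain_strict (K := K) ⟨n - 2, by omega⟩ ⟨n - 1, by omega⟩
      (by simp only; omega) (fun j => by rw [Fin.le_def]; have := j.2; simp only; omega)⟩
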